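/- arXiv:1002.3441 — 2 statements merged into one kernel-verified Lean document; each statement's English description precedes it below -/
import Mathlib

section
/- Let P and Q be finite partially ordered sets and let f : P → Q be a monotone (order-preserving) map. Suppose that for every q ∈ Q we are given a set M_q of pairs (a,b) of elements of the fiber f⁻¹(q) such that b covers a in P, every element of f⁻¹(q) occurs in at most one pair of M_q, and the modified Hasse relation of M_q restricted to f⁻¹(q) (i.e. the relation with x → y whenever x,y ∈ f⁻¹(q) and either y is covered by x in P with (y,x) ∉ M_q, or x is covered by y in P with (x,y) ∈ M_q) has no directed cycle. Then M = ⋃_{q∈Q} M_q is a matching on P (every element of P occurs in at most one pair of M) and M is acyclic: the modified Hasse relation of M on all of P, with x → y whenever either y is covered by x in P and (y,x) ∉ M, or x is covered by y in P and (x,y) ∈ M, has no directed cycle (its transitive closure is irreflexive). -/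
/-- **Patchwork lemma (Hersh, Jonsson).**
Let `P` and `Q` be finite posets and `f : P → Q` a monotone map.  Suppose for every `q ∈ Q`
we are given a set `M q` of pairs `(a, b)` of elements of the fiber `f⁻¹ q` such that `b`
covers `a` in `P`, every element of the fiber occurs in at most one pair of `M q`, and the
modified Hasse relation of `M q` restricted to the fiber has no directed cycle.  Then the
union `M = ⋃ q, M q` is a matching on `P` (every pair is a covering pair and every element
of `P` occurs in at most one pair), and `M` is acyclic: the modified Hasse relation of `M`
on all of `P` has an irreflexive transitive closure. -/
theorem patchwork_acyclic_matchings
    {P Q : Type*} [Fintype P] [PartialOrder P] [Fintype Q] [PartialOrder Q]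
    (f : P → Q) (hf : Monotone f)
    (M : Q → Set (P × P))
    -- each `M q` consists of pairs of elements of the fiber `f⁻¹ q`
    (hfib : ∀ q : Q, ∀ p ∈ M q, f p.1 = q ∧ f p.2 = q)
    -- each pair `(a, b)` of `M q` satisfies `a ⋖ b` in `P`
    (hcov : ∀ q : Q, ∀ p ∈ M q, p.1 ⋖ p.2)
    -- every element of the fiber occurs in at most one pair of `M q`
    (hmatch : ∀ q : Q, ∀ p ∈ M q, ∀ p' ∈ M q,
      (p.1 = p'.1 ∨ p.1 = p'.2 ∨ p.2 = p'.1 ∨ p.2 = p'.2) → p = p')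
    -- the modified Hasse relation of `M q` restricted to the fiber `f⁻¹ q` has no
    -- directed cycle
    (hacyc : ∀ q : Q, Irreflexive (Relation.TransGen (fun x y : P =>
      f x = q ∧ f y = q ∧
        ((y ⋖ x ∧ (y, x) ∉ M q) ∨ (x ⋖ y ∧ (x, y) ∈ M q))))) :
    -- `M = ⋃ q, M q` is a matching on `P` …
    (∀ p ∈ ⋃ q : Q, M q, p.1 ⋖ p.2) ∧
    (∀ p ∈ ⋃ q : Q, M q, ∀ p' ∈ ⋃ q : Q, M q,
      (p.1 = p'.1 ∨ p.1 = p'.2 ∨ p.2 = p'.1 ∨ p.2 = p'.2) → p = p') ∧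
    -- … and `M` is acyclic: the modified Hasse relation of `M` on `P` has no directed
    -- cycle (its transitive closure is irreflexive)
    Irreflexive (Relation.TransGen (fun x y : P =>
      (y ⋖ x ∧ (y, x) ∉ ⋃ q : Q, M q) ∨ (x ⋖ y ∧ (x, y) ∈ ⋃ q : Q, M q))) := by
  have hstep : ∀ x y : P,
      ((y ⋖ x ∧ (y, x) ∉ ⋃ q : Q, M q) ∨ (x ⋖ y ∧ (x, y) ∈ ⋃ q : Q, M q)) →
      f y ≤ f x ∧ (f x = f y → ∀ q, f x = q → (f x = q ∧ f y = q ∧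
        ((y ⋖ x ∧ (y, x) ∉ M q) ∨ (x ⋖ y ∧ (x, y) ∈ M q)))) := by
    rintro x y (⟨h, hn⟩ | ⟨h, hm⟩)
    · refine ⟨hf h.le, fun he q hq => ⟨hq, he ▸ hq, Or.inl ⟨h, fun hm => hn ?_⟩⟩⟩
      exact Set.mem_iUnion.2 ⟨q, hm⟩
    · obtain ⟨r, hr⟩ := Set.mem_iUnion.1 hm
      obtain ⟨h1, h2⟩ := hfib r _ hr
      simp only at h1 h2
      refine ⟨(h2.trans h1.symm).le, fun he q hq => ⟨hq, he ▸ hq, Or.inr ⟨h, ?_⟩⟩⟩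
      rw [← hq, h1]
      exact hr
  refine ⟨?_, ?_, ?_⟩
  · intro p hp
    obtain ⟨q, hq⟩ := Set.mem_iUnion.1 hp
    exact hcov q p hq
  · intro p hp p' hp' h
    obtain ⟨q, hq⟩ := Set.mem_iUnion.1 hp
    obtain ⟨r, hr⟩ := Set.mem_iUnion.1 hp'
    have hqr : q = r := by
      obtain ⟨a1, a2⟩ := hfib q p hq
      obtain ⟨b1, b2⟩ := hfib r p' hr
      rcases h with h | h | h | h
      · rw [← a1, ← b1, h]
      · rw [← a1, ← b2, h]
      · rw [← a2, ← b1, h]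
      · rw [← a2, ← b2, h]
    subst hqr
    exact hmatch q p hq p' hr h
  · have key : ∀ x y : P, Relation.TransGen (fun x y : P =>
        (y ⋖ x ∧ (y, x) ∉ ⋃ q : Q, M q) ∨ (x ⋖ y ∧ (x, y) ∈ ⋃ q : Q, M q)) x y →
        f y ≤ f x ∧ (f x = f y → Relation.TransGen (fun a b : P =>
          f a = f x ∧ f b = f x ∧
          ((b ⋖ a ∧ (b, a) ∉ M (f x)) ∨ (a ⋖ b ∧ (a, b) ∈ M (f x)))) x y) := by
      intro x y h
      induction h with
      | single h =>
        obtain ⟨h1, h2⟩ := hstep _ _ h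
        exact ⟨h1, fun he => Relation.TransGen.single (h2 he _ rfl)⟩
      | tail _ h ih =>
        obtain ⟨h1, h2⟩ := hstep _ _ h
        obtain ⟨i1, i2⟩ := ih
        refine ⟨h1.trans i1, fun he => ?_⟩
        have hb := le_antisymm i1 (he.le.trans h1)
        exact Relation.TransGen.tail (i2 hb.symm) (h2 (hb.trans he) _ hb)
    intro x hx
    exact hacyc (f x) x ((key x x hx).2 rfl)
end

section
/- Let n ≥ 1 and let F₁, …, Fₙ be finite partially ordered sets, each with a chosen minimal element xᵢ ∈ Fᵢ. Let P be the poset of n-tuples σ with σᵢ ∈ Option Fᵢ (where the added element none is below every element of Fᵢ), ordered componentwise, with the all-none tuple removed. Define g : P → {false < true}ⁿ (the Boolean lattice, ordered componentwise) by g(σ)ᵢ = true if σᵢ ∉ {none, some xᵢ}, and g(σ)ᵢ = false otherwise. Then g is a monotone map, and for every s ∈ {false,true}ⁿ with s ≠ (true,…,true), writing l for the smallest index with s_l = false, the operation of toggling coordinate l between none and some x_l is an involution of the fiber g⁻¹(s) ∖ {b}, where b = (some x₁, none, …, none), that pairs each element with an element covering it or covered by it in P; in particular it defines a matching on the fiber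 g⁻¹(s) whose only unmatched element is b (occurring only in the fiber of s = (false,…,false)). -/
section JoinCollapse

variable {n : ℕ} {F : Fin n → Type*} [∀ i, PartialOrder (F i)] [∀ i, DecidableEq (F i)]

/-- Toggling coordinate `l` of a tuple `σ` between `none` (= `⊥`) and `some (x l)`. -/
def toggle (x : ∀ i, F i) (l : Fin n) (σ : ∀ i, WithBot (F i)) : ∀ i, WithBot (F i) :=
  Function.update σ l (if σ l = ⊥ then (x l : WithBot (F l)) else ⊥)

/-- The map `g` to the Boolean lattice: `g σ i = true` iff `σ i ∉ {none, some (x i)}`. -/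
noncomputable def gmap (x : ∀ i, F i) (σ : ∀ i, WithBot (F i)) : Fin n → Bool :=
  fun i => decide (σ i ≠ ⊥ ∧ σ i ≠ (x i : WithBot (F i)))

/-- The special element `b = (some x₁, none, …, none)`. -/
def bElt (hn : 0 < n) (x : ∀ i, F i) : ∀ i, WithBot (F i) :=
  fun i => if i = (⟨0, hn⟩ : Fin n) then (x i : WithBot (F i)) else ⊥

end JoinCollapse

section JoinHelpers

variable {n : ℕ} {F : Fin n → Type*} [∀ i, PartialOrder (F i)] [∀ i, DecidableEq (F i)]

theorem toggle_self (x : ∀ i, F i) (l : Fin n) (σ : ∀ i, WithBot (F i)) :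
    toggle x l σ l = if σ l = ⊥ then (x l : WithBot (F l)) else ⊥ := by
  simp [toggle]

theorem toggle_ne (x : ∀ i, F i) {l j : Fin n} (h : j ≠ l) (σ : ∀ i, WithBot (F i)) :
    toggle x l σ j = σ j := by
  simp [toggle, h]

theorem gmap_false {x : ∀ i, F i} {σ : ∀ i, WithBot (F i)} {i : Fin n} :
    gmap x σ i = false ↔ σ i = ⊥ ∨ σ i = (x i : WithBot (F i)) := by
  simp only [gmap, decide_eq_false_iff_not]
  tauto

theorem toggle_toggle (x : ∀ i, F i) (l : Fin n) (σ : ∀ i, WithBot (F i))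
    (h : gmap x σ l = false) : toggle x l (toggle x l σ) = σ := by
  funext j
  by_cases hj : j = l
  · subst hj
    rw [toggle_self, toggle_self]
    rcases gmap_false.1 h with h | h <;> simp [h]
  · rw [toggle_ne x hj, toggle_ne x hj]

theorem gmap_toggle (x : ∀ i, F i) (l : Fin n) (σ : ∀ i, WithBot (F i))
    (h : gmap x σ l = false) : gmap x (toggle x l σ) = gmap x σ := by
  funext j
  by_cases hj : j = l
  · subst hj
    rw [h, gmap_false, toggle_self]
    split_ifs <;> simp
  · simp only [gmap, toggle_ne x hj]

theorem gmap_bElt (hn : 0 < n) (x : ∀ i, F i) : gmap x (bElt hn x) = fun _ => false := by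
  funext i
  rw [gmap_false]
  unfold bElt
  split_ifs <;> simp

theorem toggle_bElt (hn : 0 < n) (x : ∀ i, F i) :
    toggle x ⟨0, hn⟩ (bElt hn x) = fun _ => ⊥ := by
  funext j
  by_cases hj : j = ⟨0, hn⟩
  · subst hj
    rw [toggle_self]
    simp [bElt]
  · rw [toggle_ne x hj]
    simp [bElt, hj]

theorem toggle_bot (hn : 0 < n) (x : ∀ i, F i) :
    toggle x ⟨0, hn⟩ (fun _ => ⊥) = bElt hn x := by
  rw [← toggle_bElt hn x, toggle_toggle]
  rw [gmap_bElt]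

theorem covBy_toggle (x : ∀ i, F i) (hx : ∀ i, IsMin (x i)) (l : Fin n)
    (σ : ∀ i, WithBot (F i)) (h : σ l = ⊥) : σ ⋖ toggle x l σ := by
  have hl : toggle x l σ l = (x l : WithBot (F l)) := by rw [toggle_self, if_pos h]
  constructor
  · refine lt_of_le_of_ne (fun j => ?_) (fun e => ?_)
    · by_cases hj : j = l
      · subst hj; rw [h]; exact bot_le
      · rw [toggle_ne x hj]
    · have := congrFun e l
      rw [h, hl] at this
      exact WithBot.bot_ne_coe this
  · intro ρ h1 h2
    have hne : ∀ j, j ≠ l → ρ j = σ j := fun j hj =>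
      le_antisymm ((h2.le j).trans_eq (toggle_ne x hj σ)) (h1.le j)
    have hc : (⊥ : WithBot (F l)) ⋖ (x l : WithBot (F l)) := WithBot.bot_covBy_coe.2 (hx l)
    rcases hc.eq_or_eq bot_le ((h2.le l).trans_eq hl) with e | e
    · refine h1.ne (funext fun j => ?_)
      by_cases hj : j = l
      · subst hj; rw [h, e]
      · exact (hne j hj).symm
    · refine h2.ne (funext fun j => ?_)
      by_cases hj : j = l
      · subst hj; rw [hl, e]
      · rw [toggle_ne x hj, hne j hj]

theorem gmap_mono (x : ∀ i, F i) (hx : ∀ i, IsMin (x i)) : Monotone (gmap x) := by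
  intro σ τ h i
  by_contra hc
  have h1 : gmap x τ i = false := by
    cases h' : gmap x τ i
    · rfl
    · rw [h'] at hc; exact absurd (Bool.le_true _) hc
  have h2 : gmap x σ i = false := by
    rw [gmap_false] at h1 ⊢
    have hi := h i
    rcases h1 with h1 | h1
    · rw [h1] at hi; exact Or.inl (le_bot_iff.1 hi)
    · rw [h1] at hi
      exact (WithBot.bot_covBy_coe.2 (hx i)).eq_or_eq bot_le hi
  rw [h1, h2] at hc
  exact hc le_rfl

theorem first_index (hn : 0 < n) {s : Fin n → Bool} {l : Fin n}
    (hl : ∀ j : Fin n, j < l → s j = true) (h0 : s ⟨0, hn⟩ = false) : l = ⟨0, hn⟩ := by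
  by_contra hc
  have : (⟨0, hn⟩ : Fin n) < l := by
    rw [Fin.lt_def]
    exact Nat.pos_of_ne_zero fun h => hc (Fin.ext h)
  rw [hl _ this] at h0
  cases h0

end JoinHelpers

/-- **Fiberwise matchings on the face poset of a join (Lemma 3.5 of the paper).**
Let `n ≥ 1` and let `F₁, …, Fₙ` be finite posets with chosen minimal elements `xᵢ ∈ Fᵢ`.
Let `P` be the poset of `n`-tuples `σ` with `σᵢ ∈ Option Fᵢ` (with `none` adjoined below
every element of `Fᵢ`, i.e. `WithBot (Fᵢ)`), ordered componentwise, with the all-`none`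
tuple removed, and define `g : P → Boolⁿ` by `g σ i = true` iff `σᵢ ∉ {none, some xᵢ}`.
Then `g` is monotone, and for every `s ≠ (true, …, true)`, writing `l` for the smallest
index with `s l = false`, toggling coordinate `l` between `none` and `some (x l)` is an
involution of the fiber `g⁻¹ s` minus `b = (some x₁, none, …, none)` pairing each element
with an element covering it or covered by it in `P`; in particular it defines a matching
on the fiber whose only unmatched element is `b`, and `b` occurs only in the fiber of
`s = (false, …, false)`. -/
theorem fiberwise_matching_on_join
    {n : ℕ} (hn : 0 < n) {F : Fin n → Type*}
    [∀ i, Fintype (F i)] [∀ i, PartialOrder (F i)] [∀ i, DecidableEq (F i)]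
    (x : ∀ i, F i) (hx : ∀ i, IsMin (x i)) :
    -- the poset `P` (product of the `Option Fᵢ` with the all-`none` tuple removed)
    let P := {σ : ∀ i, WithBot (F i) // σ ≠ fun _ => ⊥}
    -- `g` is a monotone map
    Monotone (fun σ : P => gmap x σ.1) ∧
    -- `b` occurs only in the fiber of `s = (false, …, false)`
    gmap x (bElt hn x) = (fun _ => false) ∧
    -- for every `s ≠ (true, …, true)` with smallest false index `l` …
    (∀ s : Fin n → Bool, s ≠ (fun _ => true) →
      ∀ l : Fin n, s l = false → (∀ j : Fin n, j < l → s j = true) →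
      -- … toggling coordinate `l` is an involution of the fiber minus `b`
      -- pairing each element with an element covering it or covered by it in `P`:
      (∀ σ : P, gmap x σ.1 = s → σ.1 ≠ bElt hn x →
        ∃ hτ : toggle x l σ.1 ≠ fun _ => ⊥,
          gmap x (toggle x l σ.1) = s ∧
          toggle x l σ.1 ≠ bElt hn x ∧
          toggle x l (toggle x l σ.1) = σ.1 ∧
          (σ ⋖ (⟨toggle x l σ.1, hτ⟩ : P) ∨ (⟨toggle x l σ.1, hτ⟩ : P) ⋖ σ)) ∧
      -- in particular it defines a matching on the fiber `g⁻¹ s` …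
      (let Ms : Set (P × P) := {p | gmap x p.1.1 = s ∧ p.1.1 ≠ bElt hn x ∧
          p.2.1 = toggle x l p.1.1 ∧ p.1 < p.2}
      (∀ p ∈ Ms, p.1 ⋖ p.2) ∧
      (∀ p ∈ Ms, ∀ p' ∈ Ms,
        (p.1 = p'.1 ∨ p.1 = p'.2 ∨ p.2 = p'.1 ∨ p.2 = p'.2) → p = p') ∧
      -- … whose only unmatched element is `b`
      (∀ σ : P, gmap x σ.1 = s →
        ((¬ ∃ p ∈ Ms, σ = p.1 ∨ σ = p.2) ↔ σ.1 = bElt hn x)))) := by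
  intro P
  have covP : ∀ a b : P, a.1 ⋖ b.1 → a ⋖ b := fun a b h =>
    ⟨h.1, fun c h1 h2 => h.2 (c := c.1) h1 h2⟩
  refine ⟨fun a b h => gmap_mono x hx h, gmap_bElt hn x, ?_⟩
  intro s _ l hsl hmin
  have key : ∀ σ : P, gmap x σ.1 = s → σ.1 ≠ bElt hn x →
        ∃ hτ : toggle x l σ.1 ≠ fun _ => ⊥,
          gmap x (toggle x l σ.1) = s ∧
          toggle x l σ.1 ≠ bElt hn x ∧
          toggle x l (toggle x l σ.1) = σ.1 ∧
          (σ ⋖ (⟨toggle x l σ.1, hτ⟩ : P) ∨ (⟨toggle x l σ.1, hτ⟩ : P) ⋖ σ) := by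
    intro σ hσ hb
    have hfl : gmap x σ.1 l = false := by rw [hσ]; exact hsl
    have htt := toggle_toggle x l σ.1 hfl
    have hg : gmap x (toggle x l σ.1) = s := (gmap_toggle x l σ.1 hfl).trans hσ
    have hτ : toggle x l σ.1 ≠ fun _ => ⊥ := by
      intro e
      have h0 : s ⟨0, hn⟩ = false := by
        rw [← hg, e, gmap_false]; exact Or.inl rfl
      obtain rfl := first_index hn hmin h0
      rw [e, toggle_bot] at htt
      exact hb htt.symm
    refine ⟨hτ, hg, ?_, htt, ?_⟩
    · intro e
      have h0 : s ⟨0, hn⟩ = false := by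
        rw [← hg, e, gmap_bElt]
      obtain rfl := first_index hn hmin h0
      rw [e, toggle_bElt] at htt
      exact σ.2 htt.symm
    · by_cases h : σ.1 l = ⊥
      · exact Or.inl (covP _ _ (covBy_toggle x hx l σ.1 h))
      · refine Or.inr (covP _ _ ?_)
        have := covBy_toggle x hx l (toggle x l σ.1) (by rw [toggle_self, if_neg h])
        rwa [htt] at this
  refine ⟨key, ?_⟩
  intro Ms
  have back : ∀ p ∈ Ms, p.1.1 = toggle x l p.2.1 := by
    rintro p ⟨h1, h2, h3, h4⟩
    obtain ⟨_, _, _, h, _⟩ := key p.1 h1 h2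
    rw [h3, h]
  refine ⟨?_, ?_, ?_⟩
  · rintro ⟨a, b, hb⟩ ⟨h1, h2, h3, h4⟩
    obtain ⟨hτ, _, _, _, h⟩ := key a h1 h2
    dsimp only at h1 h2 h3 h4 ⊢
    subst h3
    rcases h with h | h
    · exact h
    · exact absurd (h4.trans h.lt) (lt_irrefl _)
  · rintro p hp p' hp' h
    have b1 := back p hp
    have b2 := back p' hp'
    obtain ⟨-, -, h3, h4⟩ := hp
    obtain ⟨-, -, h3', h4'⟩ := hp'
    rcases h with h | h | h | h
    · refine Prod.ext h (Subtype.ext ?_)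
      rw [h3, h3', h]
    · have : p.2 = p'.1 := Subtype.ext (by rw [h3, b2, h])
      rw [h, this] at h4
      exact absurd (h4.trans h4') (lt_irrefl _)
    · have : p.1 = p'.2 := Subtype.ext (by rw [h3', b1, h])
      rw [h, this] at h4
      exact absurd (h4.trans h4') (lt_irrefl _)
    · refine Prod.ext (Subtype.ext ?_) h
      rw [b1, b2, h]
  · intro σ hσ
    constructor
    · intro hno
      by_contra hb
      obtain ⟨hτ, hg, hb', htt, h⟩ := key σ hσ hb
      rcases h with h | h
      · exact hno ⟨(σ, ⟨_, hτ⟩), ⟨hσ, hb, rfl, h.lt⟩, Or.inl rfl⟩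
      · exact hno ⟨(⟨_, hτ⟩, σ), ⟨hg, hb', htt.symm, h.lt⟩, Or.inr rfl⟩
    · rintro hb ⟨p, ⟨h1, h2, h3, h4⟩, h | h⟩
      · exact h2 (h ▸ hb)
      · obtain ⟨_, _, h5, _⟩ := key p.1 h1 h2
        rw [← h3, ← h] at h5
        exact h5 hb
end
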